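/- Consider N robots with positions x_i : ℝ → EuclideanSpace ℝ (Fin 3), i = 1, …, N, each twice differentiable, masses m_i > 0, local damping coefficients b_i ≥ 0, symmetric inter-robot damping gains β_{i,j} = β_{j,i} ≥ 0, continuous external forces F_i : ℝ → EuclideanSpace ℝ (Fin 3), and a continuously differentiable coupling potential V : EuclideanSpace ℝ (Fin 3) → ℝ satisfying V(y) ≥ 0 and V(-y) = V(y) for all y. Suppose the robots obey m_i x_i''(t) + b_i x_i'(t) + Σ_{j ≠ i} ∇V(x_i(t) - x_j(t)) + Σ_{j ≠ i} β_{i,j} (x_i'(t) - x_j'(t)) = F_i(t) for all i and t. Then for every T ≥ 0, ∫_0^T Σ_{i=1}^N ⟨F_i(τ), x_i'(τ)⟩ dτ ≥ -( Σ_{i=1}^N (m_i/2)‖x_i'(0)‖² + Σ_{i < j} V(x_i(0) - x_j(0)) ); that is, the multi-robot system is passive with respect to the pair (external forces, robot velocities). -/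

import Mathlib

open MeasureTheory Finset
open scoped RealInnerProductSpace

/-- The gradient of an even function is odd. -/
theorem gradient_neg_of_even {E : Type*} [NormedAddCommGroup E] [InnerProductSpace ℝ E]
    [CompleteSpace E] {V : E → ℝ} (hV : Differentiable ℝ V) (heven : ∀ y, V (-y) = V y) (y : E) :
    gradient V (-y) = -gradient V y := by
  have h : HasFDerivAt (fun z => V (-z)) _ y :=
    (hV (-y)).hasGradientAt.hasFDerivAt.comp y (hasFDerivAt_id y).neg
  simp only [heven] at h
  have := h.unique (hV y).hasGradientAt.hasFDerivAt
  refine neg_eq_iff_eq_neg.mp (ext_inner_right ℝ fun v => ?_)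
  simpa using congrArg (fun L => L v) this

/-- Pairwise power identity for antisymmetric interaction forces. -/
theorem sum_inner_sum_ne_eq_sum_Ioi {ι E : Type*} [Fintype ι] [LinearOrder ι]
    [LocallyFiniteOrderTop ι] [LocallyFiniteOrderBot ι]
    [NormedAddCommGroup E] [InnerProductSpace ℝ E] (g : ι → ι → E)
    (hg : ∀ i j, g j i = -g i j) (v : ι → E) :
    ∑ i, ⟪∑ j ∈ univ.filter (· ≠ i), g i j, v i⟫ =
      ∑ i, ∑ j ∈ Ioi i, ⟪g i j, v i - v j⟫ := by
  have h := sum_sum_Ioi_add_eq_sum_sum_off_diag fun j i => ⟪g i j, v i⟫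
  have hs (i : ι) : univ.filter (· ≠ i) = ({i} : Finset ι)ᶜ := by ext; simp
  simp only [sum_inner, hs]
  rw [← h]
  refine sum_congr rfl fun i _ => sum_congr rfl fun j _ => ?_
  rw [hg i j, inner_sub_right, inner_neg_left]
  ring

/-- The derivative of the total energy of a system of point masses with pair potential `V`. -/
theorem hasDerivAt_totalEnergy {ι E : Type*} [Fintype ι] [Preorder ι] [LocallyFiniteOrderTop ι]
    [NormedAddCommGroup E] [InnerProductSpace ℝ E] [CompleteSpace E] {x x' x'' : ι → ℝ → E}
    (hx' : ∀ i t, HasDerivAt (x i) (x' i t) t) (hx'' : ∀ i t, HasDerivAt (x' i) (x'' i t) t)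
    (m : ι → ℝ) {V : E → ℝ} (hV : Differentiable ℝ V) (t : ℝ) :
    HasDerivAt
      (fun t => (∑ i, m i / 2 * ‖x' i t‖ ^ 2) + ∑ i, ∑ j ∈ Ioi i, V (x i t - x j t))
      ((∑ i, ⟪m i • x'' i t, x' i t⟫) +
        ∑ i, ∑ j ∈ Ioi i, ⟪gradient V (x i t - x j t), x' i t - x' j t⟫) t := by
  refine (HasDerivAt.fun_sum fun i _ => ?_).add
    (HasDerivAt.fun_sum fun i _ => HasDerivAt.fun_sum fun j _ => ?_)
  · refine ((hx'' i t).norm_sq.const_mul (m i / 2)).congr_deriv ?_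
    rw [real_inner_smul_left, real_inner_comm]
    ring
  · exact (hV (x i t - x j t)).hasGradientAt.hasFDerivAt.comp_hasDerivAt t
      ((hx' i t).fun_sub (hx' j t))

/-- Passivity of the multi-robot system `m_i ẍ_i + b_i ẋ_i + Σ_{j≠i} ∇V(x_i - x_j)
+ Σ_{j≠i} β_{i,j}(ẋ_i - ẋ_j) = F_i` with respect to (external forces, velocities):
for every `T ≥ 0`, `∫_0^T Σ_i ⟨F_i, ẋ_i⟩ ≥ -(initial total energy)`. -/
theorem stmt_4 (N : ℕ)
    (x x' x'' : Fin N → ℝ → EuclideanSpace ℝ (Fin 3))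
    (hx' : ∀ i t, HasDerivAt (x i) (x' i t) t)
    (hx'' : ∀ i t, HasDerivAt (x' i) (x'' i t) t)
    (m : Fin N → ℝ) (hm : ∀ i, 0 < m i)
    (b : Fin N → ℝ) (hb : ∀ i, 0 ≤ b i)
    (β : Fin N → Fin N → ℝ) (hβsymm : ∀ i j, β i j = β j i) (hβ : ∀ i j, 0 ≤ β i j)
    (F : Fin N → ℝ → EuclideanSpace ℝ (Fin 3)) (hF : ∀ i, Continuous (F i))
    (V : EuclideanSpace ℝ (Fin 3) → ℝ) (hV : ContDiff ℝ 1 V)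
    (hVnonneg : ∀ y, 0 ≤ V y) (hVeven : ∀ y, V (-y) = V y)
    (hdyn : ∀ i t, m i • x'' i t + b i • x' i t
        + (∑ j ∈ univ.filter (· ≠ i), gradient V (x i t - x j t))
        + (∑ j ∈ univ.filter (· ≠ i), β i j • (x' i t - x' j t)) = F i t) :
    ∀ T, 0 ≤ T →
      -((∑ i, m i / 2 * ‖x' i 0‖ ^ 2) + ∑ i, ∑ j ∈ Ioi i, V (x i 0 - x j 0)) ≤
        ∫ τ in (0:ℝ)..T, ∑ i, ⟪F i τ, x' i τ⟫ := by
  intro T hT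
  have hVd : Differentiable ℝ V := hV.differentiable one_ne_zero
  have hE := hasDerivAt_totalEnergy hx' hx'' m hVd
  have hcont : Continuous fun τ => ∑ i, ⟪F i τ, x' i τ⟫ :=
    continuous_finsetSum _ fun i _ =>
      (hF i).inner (continuous_iff_continuousAt.mpr fun t => (hx'' i t).continuousAt)
  have hpower (t : ℝ) : (∑ i, ⟪m i • x'' i t, x' i t⟫) +
      (∑ i, ∑ j ∈ Ioi i, ⟪gradient V (x i t - x j t), x' i t - x' j t⟫) ≤
      ∑ i, ⟪F i t, x' i t⟫ := by
    have hgrad := sum_inner_sum_ne_eq_sum_Ioi (fun i j => gradient V (x i t - x j t))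
      (fun i j => by rw [← gradient_neg_of_even hVd hVeven, neg_sub]) (fun i => x' i t)
    have hdamp := sum_inner_sum_ne_eq_sum_Ioi (fun i j => β i j • (x' i t - x' j t))
      (fun i j => by rw [hβsymm j i, ← smul_neg, neg_sub]) (fun i => x' i t)
    have hdamp_nonneg : 0 ≤ ∑ i, ∑ j ∈ Ioi i,
        ⟪β i j • (x' i t - x' j t), x' i t - x' j t⟫ :=
      sum_nonneg fun i _ => sum_nonneg fun j _ => by
        rw [real_inner_smul_left]
        exact mul_nonneg (hβ i j) real_inner_self_nonneg
    have hlocal_nonneg : 0 ≤ ∑ i, ⟪b i • x' i t, x' i t⟫ :=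
      sum_nonneg fun i _ => by
        rw [real_inner_smul_left]
        exact mul_nonneg (hb i) real_inner_self_nonneg
    simp only [← hdyn, inner_add_left, sum_add_distrib]
    linarith
  have hle := intervalIntegral.sub_le_integral_of_hasDeriv_right_of_le hT
    (fun t _ => (hE t).continuousAt.continuousWithinAt) (fun t _ => (hE t).hasDerivWithinAt)
    hcont.integrableOn_Icc (fun t _ => hpower t)
  have hET : 0 ≤ (∑ i, m i / 2 * ‖x' i T‖ ^ 2) + ∑ i, ∑ j ∈ Ioi i, V (x i T - x j T) :=
    add_nonneg
      (sum_nonneg fun i _ => mul_nonneg (half_pos (hm i)).le (sq_nonneg _))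
      (sum_nonneg fun i _ => sum_nonneg fun j _ => hVnonneg _)
  linarith
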